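/- arXiv:1307.1634 — 2 statements merged into one kernel-verified Lean document; each statement's English description precedes it below -/
import Mathlib

section
/- For g, g₁, g₂ ∈ Sp(V,Ω) the following identities hold: (i) C_{g⁻¹} = C_g*; (ii) Z_{g⁻¹} = −C_g∘Z_g∘C_g⁻¹; (iii) C_{g₁g₂} = C_{g₁}∘(Id − Z_{g₁}∘Z_{g₂⁻¹})∘C_{g₂}; (iv) Z_{g₁g₂} = C_{g₂}⁻¹∘(Id − Z_{g₁}∘Z_{g₂⁻¹})⁻¹∘(Z_{g₁} − Z_{g₂⁻¹})∘C_{g₂}. -/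
/-- The Hermitean inner product `⟨v,w⟩_j := Ω(v,jw) − i·Ω(v,w)`. -/
noncomputable def herm {V : Type*} [AddCommGroup V] [Module ℝ V]
    (Ω : V →ₗ[ℝ] V →ₗ[ℝ] ℝ) (j : Module.End ℝ V) (v w : V) : ℂ :=
  (Ω v (j w) : ℂ) - Complex.I * (Ω v w : ℂ)

/-- `C_g := ½(g − j∘g∘j)`. -/
noncomputable def Cmap {V : Type*} [AddCommGroup V] [Module ℝ V]
    (j g : Module.End ℝ V) : Module.End ℝ V := (1/2 : ℝ) • (g - j * g * j)

/-- `D_g := ½(g + j∘g∘j)`. -/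
noncomputable def Dmap {V : Type*} [AddCommGroup V] [Module ℝ V]
    (j g : Module.End ℝ V) : Module.End ℝ V := (1/2 : ℝ) • (g + j * g * j)

/-- `Z_g := C_g⁻¹ ∘ D_g`. -/
noncomputable def Zmap {V : Type*} [AddCommGroup V] [Module ℝ V]
    (j g : Module.End ℝ V) : Module.End ℝ V := Ring.inverse (Cmap j g) * Dmap j g

section CD

variable {V : Type*} [AddCommGroup V] [Module ℝ V]

theorem Cmap_mul {j : Module.End ℝ V} (hj2 : j * j = -1) (a b : Module.End ℝ V) :
    Cmap j (a * b) = Cmap j a * Cmap j b + Dmap j a * Dmap j b := by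
  have key : j * a * j * (j * b * j) = -(j * (a * b) * j) := by
    calc j * a * j * (j * b * j) = j * a * (j * j) * b * j := by simp only [mul_assoc]
      _ = -(j * (a * b) * j) := by rw [hj2]; noncomm_ring
  simp only [Cmap, Dmap, smul_mul_assoc, mul_smul_comm, sub_mul, mul_sub, add_mul,
    mul_add, key]
  module

theorem Dmap_mul {j : Module.End ℝ V} (hj2 : j * j = -1) (a b : Module.End ℝ V) :
    Dmap j (a * b) = Cmap j a * Dmap j b + Dmap j a * Cmap j b := by
  have key : j * a * j * (j * b * j) = -(j * (a * b) * j) := by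
    calc j * a * j * (j * b * j) = j * a * (j * j) * b * j := by simp only [mul_assoc]
      _ = -(j * (a * b) * j) := by rw [hj2]; noncomm_ring
  simp only [Cmap, Dmap, smul_mul_assoc, mul_smul_comm, sub_mul, mul_sub, add_mul,
    mul_add, key]
  module

theorem Dmap_one {j : Module.End ℝ V} (hj2 : j * j = -1) : Dmap j 1 = 0 := by
  simp [Dmap, hj2]

theorem isUnit_end_of_bijective {g : Module.End ℝ V} (hg : Function.Bijective g) : IsUnit g :=
  (Module.End.isUnit_iff g).2 hg

/-- `C_g` is invertible for symplectic `g`. -/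
theorem isUnit_Cmap [FiniteDimensional ℝ V] {Ω : V →ₗ[ℝ] V →ₗ[ℝ] ℝ} {j : Module.End ℝ V}
    (hj2 : j * j = -1) (hjpos : ∀ v, v ≠ 0 → 0 < Ω v (j v)) {g : Module.End ℝ V}
    (hg : Function.Bijective g) (hgsymp : ∀ v w, Ω (g v) (g w) = Ω v w) :
    IsUnit (Cmap j g) := by
  have hinj : Function.Injective (Cmap j g) := by
    rw [injective_iff_map_eq_zero]
    intro v hv
    by_contra hv0
    have hjj : ∀ w, j (j w) = -w := fun w => by simpa using LinearMap.congr_fun hj2 w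
    have h1 : g v = j (g (j v)) := by
      simpa [Cmap, sub_eq_zero] using hv
    have h2 : j (g v) = -g (j v) := by rw [h1, hjj]
    have h3 := hjpos (g v) fun h => hv0 (hg.1 (h.trans (map_zero g).symm))
    rw [h2, map_neg, hgsymp] at h3
    linarith [hjpos v hv0]
  exact isUnit_end_of_bijective ⟨hinj, LinearMap.injective_iff_surjective.1 hinj⟩

theorem Cmap_adjoint {Ω : V →ₗ[ℝ] V →ₗ[ℝ] ℝ} {j g h : Module.End ℝ V} (hj2 : j * j = -1)
    (hjsymp : ∀ v w, Ω (j v) (j w) = Ω v w) (hgsymp : ∀ v w, Ω (g v) (g w) = Ω v w)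
    (hgh : g * h = 1) (v w : V) : Ω (Cmap j g v) w = Ω v (Cmap j h w) := by
  have hjj : ∀ w, j (j w) = -w := fun w => by simpa using LinearMap.congr_fun hj2 w
  have hg : ∀ v w, Ω (g v) w = Ω v (h w) := fun v w => by
    rw [← hgsymp v (h w), show g (h w) = w from LinearMap.congr_fun hgh w]
  have hj : ∀ v w, Ω (j v) w = -Ω v (j w) := fun v w => by
    rw [← hjsymp v (j w), hjj, map_neg, neg_neg]
  simp [Cmap, hg, hj]

theorem Zmap_inverse_mul_Cmap {j g h : Module.End ℝ V} (hj2 : j * j = -1) (hhg : h * g = 1)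
    (hC : IsUnit (Cmap j h)) : Zmap j h * Cmap j g = -Dmap j g := by
  have hD := Dmap_mul hj2 h g
  rw [hhg, Dmap_one hj2] at hD
  rw [Zmap, mul_assoc, eq_neg_of_add_eq_zero_right hD.symm, mul_neg, ← mul_assoc,
    Ring.inverse_mul_cancel _ hC, one_mul]

theorem Cmap_mul_Zmap {j g : Module.End ℝ V} (hC : IsUnit (Cmap j g)) :
    Cmap j g * Zmap j g = Dmap j g := by
  rw [Zmap, ← mul_assoc, Ring.mul_inverse_cancel _ hC, one_mul]

end CD

/-- the identities (i) `C_{g⁻¹} = C_g*`;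
(ii) `Z_{g⁻¹} = −C_g ∘ Z_g ∘ C_g⁻¹`;
(iii) `C_{g₁g₂} = C_{g₁} ∘ (Id − Z_{g₁}Z_{g₂⁻¹}) ∘ C_{g₂}`;
(iv) `Z_{g₁g₂} = C_{g₂}⁻¹ ∘ (Id − Z_{g₁}Z_{g₂⁻¹})⁻¹ ∘ (Z_{g₁} − Z_{g₂⁻¹}) ∘ C_{g₂}`. -/
theorem stmt2 {V : Type*} [AddCommGroup V] [Module ℝ V] [FiniteDimensional ℝ V]
    (Ω : V →ₗ[ℝ] V →ₗ[ℝ] ℝ)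
    (hΩalt : ∀ v, Ω v v = 0)
    (hΩnondeg : ∀ v, (∀ w, Ω v w = 0) → v = 0)
    (j : Module.End ℝ V)
    (hj2 : j * j = -1)
    (hjsymp : ∀ v w, Ω (j v) (j w) = Ω v w)
    (hjpos : ∀ v, v ≠ 0 → 0 < Ω v (j v))
    (g g₁ g₂ : Module.End ℝ V)
    (hgbij : Function.Bijective g) (hgsymp : ∀ v w, Ω (g v) (g w) = Ω v w)
    (hg₁bij : Function.Bijective g₁) (hg₁symp : ∀ v w, Ω (g₁ v) (g₁ w) = Ω v w)
    (hg₂bij : Function.Bijective g₂) (hg₂symp : ∀ v w, Ω (g₂ v) (g₂ w) = Ω v w) :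
    (∀ Cs : Module.End ℝ V,
      (∀ v w, herm Ω j (Cmap j g v) w = herm Ω j v (Cs w)) →
        Cmap j (Ring.inverse g) = Cs)
    ∧ Zmap j (Ring.inverse g) = -(Cmap j g * Zmap j g * Ring.inverse (Cmap j g))
    ∧ Cmap j (g₁ * g₂)
        = Cmap j g₁ * (1 - Zmap j g₁ * Zmap j (Ring.inverse g₂)) * Cmap j g₂
    ∧ Zmap j (g₁ * g₂)
        = Ring.inverse (Cmap j g₂)
          * Ring.inverse (1 - Zmap j g₁ * Zmap j (Ring.inverse g₂))
          * (Zmap j g₁ - Zmap j (Ring.inverse g₂)) * Cmap j g₂ := by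
  have hinv : ∀ f : Module.End ℝ V, Function.Bijective f →
      (∀ v w, Ω (f v) (f w) = Ω v w) → IsUnit (Cmap j (Ring.inverse f)) := by
    intro f hf hfs
    have hu := isUnit_end_of_bijective hf
    have hfi : ∀ v, f (Ring.inverse f v) = v :=
      fun v => LinearMap.congr_fun (Ring.mul_inverse_cancel f hu) v
    refine isUnit_Cmap hj2 hjpos ((Module.End.isUnit_iff _).1 hu.ringInverse) fun v w => ?_
    rw [← hfs, hfi, hfi]
  have hug := isUnit_end_of_bijective hgbij
  have hu₂ := isUnit_end_of_bijective hg₂bij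
  have hC := isUnit_Cmap hj2 hjpos hgbij hgsymp
  have hC₁ := isUnit_Cmap hj2 hjpos hg₁bij hg₁symp
  have hC₂ := isUnit_Cmap hj2 hjpos hg₂bij hg₂symp
  have hC₁₂ : IsUnit (Cmap j (g₁ * g₂)) :=
    isUnit_Cmap hj2 hjpos (hg₁bij.comp hg₂bij) fun v w => (hg₁symp _ _).trans (hg₂symp v w)
  have hZ := Zmap_inverse_mul_Cmap hj2 (Ring.inverse_mul_cancel g hug) (hinv g hgbij hgsymp)
  have hZ₂ := Zmap_inverse_mul_Cmap hj2 (Ring.inverse_mul_cancel g₂ hu₂)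
    (hinv g₂ hg₂bij hg₂symp)
  have hiii : Cmap j (g₁ * g₂)
      = Cmap j g₁ * (1 - Zmap j g₁ * Zmap j (Ring.inverse g₂)) * Cmap j g₂ := by
    rw [mul_assoc, sub_mul, one_mul, mul_assoc, hZ₂, mul_neg, sub_neg_eq_add, mul_add,
      ← mul_assoc _ (Zmap j g₁), Cmap_mul_Zmap hC₁, Cmap_mul hj2]
  refine ⟨fun Cs hCs => ?_, ?_, hiii, ?_⟩
  · ext w
    rw [← sub_eq_zero]
    refine hΩnondeg _ fun v => ?_
    have h1 := congrArg Complex.im (hCs v w)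
    simp only [herm, Complex.sub_im, Complex.ofReal_im, Complex.mul_im, Complex.I_re,
      Complex.I_im, Complex.ofReal_re, zero_mul, one_mul, zero_add, zero_sub, neg_inj] at h1
    rw [Cmap_adjoint hj2 hjsymp hgsymp (Ring.mul_inverse_cancel g hug)] at h1
    have hanti : ∀ x y, Ω x y = -Ω y x := fun x y => by
      have := hΩalt (x + y)
      simp only [map_add, LinearMap.add_apply, hΩalt] at this
      linarith
    rw [hanti, map_sub, h1, sub_self, neg_zero]
  · rw [Cmap_mul_Zmap hC, ← neg_mul, ← hZ, mul_assoc, Ring.mul_inverse_cancel _ hC, mul_one]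
  · have hu : IsUnit (1 - Zmap j g₁ * Zmap j (Ring.inverse g₂)) := by
      rw [hiii, hC₂.mul_right_iff, hC₁.mul_left_iff] at hC₁₂
      exact hC₁₂
    refine hC₁₂.mul_left_cancel ?_
    rw [Cmap_mul_Zmap hC₁₂, hiii]
    set K := 1 - Zmap j g₁ * Zmap j (Ring.inverse g₂)
    calc Dmap j (g₁ * g₂)
        = Cmap j g₁ * (Zmap j g₁ - Zmap j (Ring.inverse g₂)) * Cmap j g₂ := by
          rw [mul_sub, sub_mul, mul_assoc _ (Zmap j (Ring.inverse g₂)), hZ₂, Cmap_mul_Zmap hC₁,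
            Dmap_mul hj2, mul_neg, sub_neg_eq_add, add_comm]
      _ = Cmap j g₁ * (K * (Cmap j g₂ * Ring.inverse (Cmap j g₂)) * Ring.inverse K)
            * (Zmap j g₁ - Zmap j (Ring.inverse g₂)) * Cmap j g₂ := by
          rw [Ring.mul_inverse_cancel _ hC₂, mul_one, Ring.mul_inverse_cancel _ hu, mul_one]
      _ = _ := by simp only [mul_assoc]
end

section
/- Let sp(V,Ω) denote the Lie algebra of ℝ-linear endomorphisms A of V with Ω(Av,w) + Ω(v,Aw) = 0, and for u ∈ V let u̲ ⊗ w denote the endomorphism x ↦ Ω(u,x)w. There is a unique linear map ν from sp(V,Ω) to the ℂ-linear endomorphisms of Pol(V,j) such that ν(v̲⊗w + w̲⊗v) = −(iħ/2)(cl(v)∘cl(w) + cl(w)∘cl(v)) for all v,w ∈ V; moreover ν is a homomorphism of Lie algebras (with the commutator bracket on operators), and [ν(A), cl(x)] = cl(Ax) for every A ∈ sp(V,Ω) and x ∈ V. -/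
/-- The space `Pol(V,j)` of holomorphic polynomial functions on `(V,j)`. -/
noncomputable def Pol (V : Type*) [AddCommGroup V] [Module ℂ V] : Subalgebra ℂ (V → ℂ) :=
  Algebra.adjoin ℂ (Set.range fun φ : V →ₗ[ℂ] ℂ => (φ : V → ℂ))

/-- Symplectic Clifford multiplication
`(cl(v)f)(z) = (1/2ħ)⟨z,v⟩_j f(z) − (∂f)_z(v)`. -/
noncomputable def clOp {V : Type*} [AddCommGroup V] [Module ℂ V]
    (hbar : ℝ) (Ω : V →ₗ[ℝ] V →ₗ[ℝ] ℝ) (v : V) (f : V → ℂ) : V → ℂ :=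
  fun z => (1 / (2 * (hbar : ℂ)))
      * ((Ω z (Complex.I • v) : ℂ) - Complex.I * (Ω z v : ℂ)) * f z
    - lineDeriv ℝ f z v

/-- Membership in the symplectic Lie algebra `sp(V,Ω)`. -/
def IsSp {V : Type*} [AddCommGroup V] [Module ℝ V]
    (Ω : V →ₗ[ℝ] V →ₗ[ℝ] ℝ) (A : Module.End ℝ V) : Prop :=
  ∀ v w, Ω (A v) w + Ω v (A w) = 0

/-- The endomorphism `u̲ ⊗ w : x ↦ Ω(u,x)·w`. -/
def sOp {V : Type*} [AddCommGroup V] [Module ℝ V]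
    (Ω : V →ₗ[ℝ] V →ₗ[ℝ] ℝ) (u w : V) : Module.End ℝ V :=
  (Ω u).smulRight w

section SymplecticFrame

variable {V ι : Type*} [AddCommGroup V] [Module ℝ V] [Fintype ι]
  {Ω : V →ₗ[ℝ] V →ₗ[ℝ] ℝ} {b : Module.Basis ι ℝ V} {u : ι → V}

theorem sum_smul_symplecticDual (hnd : ∀ v, (∀ w, Ω v w = 0) → v = 0)
    (hu : ∀ i x, Ω (u i) x = b.repr x i) (v : V) : ∑ i, Ω v (b i) • u i = v := by
  rw [← sub_eq_zero]
  refine hnd _ fun x => ?_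
  have h : Ω v x = ∑ i, b.repr x i * Ω v (b i) := by
    conv_lhs => rw [← b.sum_repr x]
    simp only [map_sum, map_smul, smul_eq_mul]
  simp [hu, h, mul_comm]

theorem exists_symplecticDual (hnd : ∀ v, (∀ w, Ω v w = 0) → v = 0) (b : Module.Basis ι ℝ V) :
    ∃ u : ι → V, ∀ i x, Ω (u i) x = b.repr x i := by
  have : FiniteDimensional ℝ V := Module.Finite.of_basis b
  have hinj : Function.Injective Ω := by
    rw [injective_iff_map_eq_zero]
    exact fun v hv => hnd v fun w => by simp [hv]
  have hsurj : Function.Surjective Ω :=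
    (LinearMap.injective_iff_surjective_of_finrank_eq_finrank
      (Subspace.dual_finrank_eq (K := ℝ) (V := V)).symm).1 hinj
  choose u hu using fun i => hsurj (b.coord i)
  exact ⟨u, fun i x => by rw [hu]; rfl⟩

theorem isSp_sOp_add (halt : ∀ v, Ω v v = 0) (v w : V) :
    IsSp Ω (sOp Ω v w + sOp Ω w v) := by
  intro x y
  have hneg : ∀ p q, Ω p q = -Ω q p := fun p q => (LinearMap.IsAlt.neg halt q p).symm
  simp only [sOp, LinearMap.add_apply, LinearMap.smulRight_apply, map_add, map_smul,
    LinearMap.smul_apply, smul_eq_mul]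
  rw [hneg x w, hneg x v]
  ring

theorem sum_sOp_left (hu : ∀ i x, Ω (u i) x = b.repr x i) (A : Module.End ℝ V) (x : V) :
    ∑ i, Ω (u i) x • A (b i) = A x := by
  simp_rw [hu, ← map_smul, ← map_sum, b.sum_repr]

theorem sum_sOp_right (halt : ∀ v, Ω v v = 0) (hnd : ∀ v, (∀ w, Ω v w = 0) → v = 0)
    (hu : ∀ i x, Ω (u i) x = b.repr x i) {A : Module.End ℝ V} (hA : IsSp Ω A) (x : V) :
    ∑ i, Ω (A (b i)) x • u i = A x := by
  have hneg : ∀ p q, Ω p q = -Ω q p := fun p q => (LinearMap.IsAlt.neg halt q p).symm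
  conv_rhs => rw [← sum_smul_symplecticDual hnd hu (A x)]
  refine Finset.sum_congr rfl fun i _ => ?_
  rw [hneg (A x), ← neg_eq_of_add_eq_zero_left (hA (b i) x)]

theorem eq_half_sum_sOp (halt : ∀ v, Ω v v = 0) (hnd : ∀ v, (∀ w, Ω v w = 0) → v = 0)
    (hu : ∀ i x, Ω (u i) x = b.repr x i) {A : Module.End ℝ V} (hA : IsSp Ω A) :
    A = ∑ i, (1 / 2 : ℝ) • (sOp Ω (u i) (A (b i)) + sOp Ω (A (b i)) (u i)) := by
  ext x
  simp only [sOp, LinearMap.sum_apply, LinearMap.smul_apply, LinearMap.add_apply,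
    LinearMap.smulRight_apply]
  rw [← Finset.smul_sum, Finset.sum_add_distrib, sum_sOp_left hu, sum_sOp_right halt hnd hu hA,
    ← two_smul ℝ (A x), smul_smul]
  norm_num

section Quantization

variable {E : Type*} [Ring E] [Algebra ℂ E]

/-- The symmetrized product `cl v * cl w + cl w * cl v`, as a bilinear map. -/
noncomputable def symProd (cl : V →ₗ[ℝ] E) : V →ₗ[ℝ] V →ₗ[ℝ] E :=
  (LinearMap.mul ℝ E).compl₁₂ cl cl + ((LinearMap.mul ℝ E).compl₁₂ cl cl).flip

theorem symProd_apply (cl : V →ₗ[ℝ] E) (v w : V) :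
    symProd cl v w = cl v * cl w + cl w * cl v := rfl

theorem symProd_comm (cl : V →ₗ[ℝ] E) (v w : V) : symProd cl v w = symProd cl w v := by
  rw [symProd_apply, symProd_apply, add_comm]

/-- The metaplectic representation written in a basis `b` with `Ω`-dual family `u`. -/
noncomputable def metaplectic (hbar : ℝ) (b : Module.Basis ι ℝ V) (u : ι → V)
    (cl : V →ₗ[ℝ] E) (A : Module.End ℝ V) : E :=
  (-(Complex.I * (hbar : ℂ)) / 4) • ∑ i, symProd cl (u i) (A (b i))

variable {hbar : ℝ} {cl : V →ₗ[ℝ] E}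

theorem metaplectic_add (A B : Module.End ℝ V) :
    metaplectic hbar b u cl (A + B) = metaplectic hbar b u cl A + metaplectic hbar b u cl B := by
  simp [metaplectic, Finset.sum_add_distrib]

theorem metaplectic_smul (c : ℝ) (A : Module.End ℝ V) :
    metaplectic hbar b u cl (c • A) = c • metaplectic hbar b u cl A := by
  simp only [metaplectic, LinearMap.smul_apply, map_smul, ← Finset.smul_sum]
  rw [smul_comm]

theorem metaplectic_sOp_add (hnd : ∀ v, (∀ w, Ω v w = 0) → v = 0)
    (hu : ∀ i x, Ω (u i) x = b.repr x i) (v w : V) :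
    metaplectic hbar b u cl (sOp Ω v w + sOp Ω w v)
      = (-(Complex.I * (hbar : ℂ)) / 2) • (cl v * cl w + cl w * cl v) := by
  have h : ∀ p q, ∑ i, symProd cl (u i) (sOp Ω p q (b i)) = symProd cl p q := by
    intro p q
    conv_rhs => rw [← sum_smul_symplecticDual hnd hu p]
    simp [sOp]
  simp only [metaplectic, LinearMap.add_apply, map_add, Finset.sum_add_distrib]
  rw [h, h, symProd_comm cl w v, ← two_smul ℂ, smul_smul, symProd_apply]
  congr 1
  ring

theorem symProd_commutator
    (hcl : ∀ v w, cl v * cl w - cl w * cl v = (Complex.I / hbar * (Ω v w : ℂ)) • (1 : E))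
    (v w x : V) :
    symProd cl v w * cl x - cl x * symProd cl v w
      = (2 * Complex.I / hbar) • cl (Ω v x • w + Ω w x • v) := by
  have e : symProd cl v w * cl x - cl x * symProd cl v w
      = cl v * (cl w * cl x - cl x * cl w) + (cl v * cl x - cl x * cl v) * cl w
        + (cl w * (cl v * cl x - cl x * cl v) + (cl w * cl x - cl x * cl w) * cl v) := by
    rw [symProd_apply]
    noncomm_ring
  rw [e, hcl, hcl]
  simp only [map_add, map_smul, mul_smul_comm, smul_mul_assoc, one_mul, mul_one, smul_add,
    ← Complex.coe_smul, smul_smul]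
  module

theorem metaplectic_commutator (hbar0 : hbar ≠ 0)
    (halt : ∀ v, Ω v v = 0) (hnd : ∀ v, (∀ w, Ω v w = 0) → v = 0)
    (hu : ∀ i x, Ω (u i) x = b.repr x i)
    (hcl : ∀ v w, cl v * cl w - cl w * cl v = (Complex.I / hbar * (Ω v w : ℂ)) • (1 : E))
    {A : Module.End ℝ V} (hA : IsSp Ω A) (x : V) :
    metaplectic hbar b u cl A * cl x - cl x * metaplectic hbar b u cl A = cl (A x) := by
  have hc : (hbar : ℂ) ≠ 0 := by exact_mod_cast hbar0
  rw [metaplectic, smul_mul_assoc, mul_smul_comm, ← smul_sub, Finset.sum_mul, Finset.mul_sum,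
    ← Finset.sum_sub_distrib]
  simp_rw [symProd_commutator hcl]
  rw [← Finset.smul_sum, ← map_sum, Finset.sum_add_distrib, sum_sOp_left hu,
    sum_sOp_right halt hnd hu hA, map_add, ← two_smul ℂ, smul_smul, smul_smul]
  have : -(Complex.I * (hbar : ℂ)) / 4 * (2 * Complex.I / hbar) * 2 = 1 := by
    field_simp
    linear_combination (-4 : ℂ) * Complex.I_sq
  rw [this, one_smul]

theorem metaplectic_lie (hbar0 : hbar ≠ 0)
    (halt : ∀ v, Ω v v = 0) (hnd : ∀ v, (∀ w, Ω v w = 0) → v = 0)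
    (hu : ∀ i x, Ω (u i) x = b.repr x i)
    (hcl : ∀ v w, cl v * cl w - cl w * cl v = (Complex.I / hbar * (Ω v w : ℂ)) • (1 : E))
    {A : Module.End ℝ V} (hA : IsSp Ω A) (B : Module.End ℝ V) :
    metaplectic hbar b u cl (A * B - B * A)
      = metaplectic hbar b u cl A * metaplectic hbar b u cl B
        - metaplectic hbar b u cl B * metaplectic hbar b u cl A := by
  set N := metaplectic hbar b u cl A with hN
  have hS : ∀ x y, N * symProd cl x y - symProd cl x y * N
      = symProd cl (A x) y + symProd cl x (A y) := by
    intro x y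
    rw [symProd_apply, symProd_apply, symProd_apply,
      ← metaplectic_commutator hbar0 halt hnd hu hcl hA x,
      ← metaplectic_commutator hbar0 halt hnd hu hcl hA y, ← hN]
    noncomm_ring
  have hswap : ∑ i, symProd cl (A (u i)) (B (b i)) = -∑ k, symProd cl (u k) (B (A (b k))) := by
    have h1 : ∀ i, A (u i) = -∑ k, b.repr (A (b k)) i • u k := by
      intro i
      rw [← sum_smul_symplecticDual hnd hu (A (u i)), ← Finset.sum_neg_distrib]
      refine Finset.sum_congr rfl fun k _ => ?_
      rw [← hu, ← neg_smul, eq_neg_of_add_eq_zero_left (hA (u i) (b k))]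
    have h2 : ∀ k, B (A (b k)) = ∑ i, b.repr (A (b k)) i • B (b i) := by
      intro k
      conv_lhs => rw [← b.sum_repr (A (b k))]
      simp only [map_sum, map_smul]
    simp_rw [h1, h2]
    simp only [map_neg, map_sum, map_smul, LinearMap.neg_apply, LinearMap.sum_apply,
      LinearMap.smul_apply, Finset.sum_neg_distrib]
    rw [Finset.sum_comm]
  conv_rhs => rw [metaplectic]
  rw [mul_smul_comm, smul_mul_assoc, ← smul_sub, Finset.sum_mul, Finset.mul_sum,
    ← Finset.sum_sub_distrib]
  simp_rw [hS]
  rw [Finset.sum_add_distrib, hswap, metaplectic]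
  simp only [LinearMap.sub_apply, Module.End.mul_apply, map_sub, Finset.sum_sub_distrib]
  congr 1
  abel

end Quantization

end SymplecticFrame

section Pol

variable {V : Type*} [AddCommGroup V] [Module ℂ V]

theorem linearMap_mem_Pol (φ : V →ₗ[ℂ] ℂ) : (φ : V → ℂ) ∈ Pol V :=
  Algebra.subset_adjoin ⟨φ, rfl⟩

theorem exists_derivative_of_mem_Pol {f : V → ℂ} (hf : f ∈ Pol V) :
    ∃ D : V → V → ℂ, (∀ v, D v ∈ Pol V) ∧ (∀ v w, D (v + w) = D v + D w)
      ∧ (∀ (c : ℝ) v, D (c • v) = (c : ℂ) • D v)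
      ∧ ∀ z v, HasLineDerivAt ℝ f (D v z) z v := by
  induction hf using Algebra.adjoin_induction with
  | mem f hf =>
    obtain ⟨φ, rfl⟩ := hf
    refine ⟨fun v _ => φ v, fun v => (Pol V).algebraMap_mem (φ v), fun v w => ?_, fun c v => ?_,
      fun z v => ?_⟩
    · ext; simp
    · ext; simp [← Complex.coe_smul]
    · have h : HasDerivAt (fun t : ℝ => φ z + t • φ v) (φ v) 0 := by
        simpa using ((hasDerivAt_id (0 : ℝ)).smul_const (φ v)).const_add (φ z)
      simpa [HasLineDerivAt, ← Complex.coe_smul] using h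
  | algebraMap r =>
    refine ⟨fun _ => 0, fun _ => (Pol V).zero_mem, by simp, by simp, fun z v => ?_⟩
    exact hasDerivAt_const (0 : ℝ) r
  | add f g _ _ hf hg =>
    obtain ⟨D, hD, hadd, hsmul, hder⟩ := hf
    obtain ⟨D', hD', hadd', hsmul', hder'⟩ := hg
    refine ⟨fun v => D v + D' v, fun v => (Pol V).add_mem (hD v) (hD' v), fun v w => ?_,
      fun c v => ?_, fun z v => (hder z v).add (hder' z v)⟩
    · simp only [hadd, hadd']; abel
    · simp only [hsmul, hsmul', smul_add]
  | mul f g hf0 hg0 hf hg =>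
    obtain ⟨D, hD, hadd, hsmul, hder⟩ := hf
    obtain ⟨D', hD', hadd', hsmul', hder'⟩ := hg
    refine ⟨fun v => D v * g + f * D' v,
      fun v => (Pol V).add_mem ((Pol V).mul_mem (hD v) hg0) ((Pol V).mul_mem hf0 (hD' v)),
      fun v w => ?_, fun c v => ?_, fun z v => ?_⟩
    · simp only [hadd, hadd']; ring
    · simp only [hsmul, hsmul', smul_add, smul_mul_assoc, mul_smul_comm]
    · have h : HasDerivAt _ _ _ := HasDerivAt.mul (hder z v) (hder' z v)
      simp only [zero_smul, add_zero] at h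
      exact h

theorem hasLineDerivAt_of_mem_Pol {f : V → ℂ} (hf : f ∈ Pol V) (z v : V) :
    HasLineDerivAt ℝ f (lineDeriv ℝ f z v) z v := by
  obtain ⟨D, -, -, -, h⟩ := exists_derivative_of_mem_Pol hf
  rw [(h z v).lineDeriv]
  exact h z v

theorem lineDeriv_mem_Pol {f : V → ℂ} (hf : f ∈ Pol V) (v : V) :
    (fun z => lineDeriv ℝ f z v) ∈ Pol V := by
  obtain ⟨D, hD, -, -, h⟩ := exists_derivative_of_mem_Pol hf
  convert hD v using 1
  exact funext fun z => (h z v).lineDeriv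

theorem lineDeriv_add_of_mem_Pol {f : V → ℂ} (hf : f ∈ Pol V) (z v w : V) :
    lineDeriv ℝ f z (v + w) = lineDeriv ℝ f z v + lineDeriv ℝ f z w := by
  obtain ⟨D, -, hadd, -, h⟩ := exists_derivative_of_mem_Pol hf
  rw [(h z _).lineDeriv, (h z _).lineDeriv, (h z _).lineDeriv, hadd, Pi.add_apply]

theorem lineDeriv_mul_of_mem_Pol {f g : V → ℂ} (hf : f ∈ Pol V) (hg : g ∈ Pol V) (z v : V) :
    lineDeriv ℝ (f * g) z v = lineDeriv ℝ f z v * g z + f z * lineDeriv ℝ g z v := by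
  have h : HasDerivAt _ _ _ :=
    HasDerivAt.mul (hasLineDerivAt_of_mem_Pol hf z v) (hasLineDerivAt_of_mem_Pol hg z v)
  simp only [zero_smul, add_zero] at h
  exact HasLineDerivAt.lineDeriv h

/-- The directional derivative along `v`, as a derivation of `Pol V`. -/
noncomputable def polDeriv (v : V) : Derivation ℂ (Pol V) (Pol V) :=
  Derivation.mk'
    { toFun := fun f => ⟨fun z => lineDeriv ℝ (f : V → ℂ) z v, lineDeriv_mem_Pol f.2 v⟩
      map_add' := fun f g => Subtype.ext <| funext fun z =>
        HasLineDerivAt.lineDeriv ((hasLineDerivAt_of_mem_Pol f.2 z v).add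
          (hasLineDerivAt_of_mem_Pol g.2 z v))
      map_smul' := fun c f => Subtype.ext <| funext fun z =>
        HasLineDerivAt.lineDeriv
          (HasDerivAt.const_mul c (hasLineDerivAt_of_mem_Pol f.2 z v)) }
    fun f g => Subtype.ext <| funext fun z => by
      refine (lineDeriv_mul_of_mem_Pol f.2 g.2 z v).trans ?_
      change _ = (f : V → ℂ) z * lineDeriv ℝ (g : V → ℂ) z v
        + (g : V → ℂ) z * lineDeriv ℝ (f : V → ℂ) z v
      ring

theorem polDeriv_apply (v : V) (f : Pol V) (z : V) :
    (polDeriv v f : V → ℂ) z = lineDeriv ℝ (f : V → ℂ) z v := rfl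

theorem polDeriv_linearMap (v : V) (φ : V →ₗ[ℂ] ℂ) :
    polDeriv v ⟨φ, linearMap_mem_Pol φ⟩ = algebraMap ℂ (Pol V) (φ v) := by
  refine Subtype.ext <| funext fun z => HasLineDerivAt.lineDeriv ?_
  change HasDerivAt (fun t : ℝ => φ (z + t • v)) (φ v) 0
  have h : HasDerivAt (fun t : ℝ => φ z + t • φ v) (φ v) 0 := by
    simpa using ((hasDerivAt_id (0 : ℝ)).smul_const (φ v)).const_add (φ z)
  simpa [← Complex.coe_smul] using h

theorem polDeriv_add (v w : V) (f : Pol V) :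
    polDeriv (v + w) f = polDeriv v f + polDeriv w f :=
  Subtype.ext <| funext fun z => lineDeriv_add_of_mem_Pol f.2 z v w

theorem polDeriv_smul (c : ℝ) (v : V) (f : Pol V) :
    polDeriv (c • v) f = c • polDeriv v f :=
  Subtype.ext <| funext fun _ => lineDeriv_smul

theorem polDeriv_comm (v w : V) (f : Pol V) :
    polDeriv v (polDeriv w f) = polDeriv w (polDeriv v f) := by
  obtain ⟨f, hf⟩ := f
  rw [← sub_eq_zero, ← Derivation.commutator_apply]
  induction hf using Algebra.adjoin_induction with
  | mem f hf =>
    obtain ⟨φ, rfl⟩ := hf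
    rw [Derivation.commutator_apply]
    erw [polDeriv_linearMap, polDeriv_linearMap]
    simp
  | algebraMap r => exact Derivation.map_algebraMap ⁅polDeriv v, polDeriv w⁆ r
  | add f g hf0 hg0 hf hg =>
    refine (map_add ⁅polDeriv v, polDeriv w⁆ (⟨f, hf0⟩ : Pol V) ⟨g, hg0⟩).trans ?_
    rw [hf, hg, add_zero]
  | mul f g hf0 hg0 hf hg =>
    refine (Derivation.leibniz ⁅polDeriv v, polDeriv w⁆ (⟨f, hf0⟩ : Pol V) ⟨g, hg0⟩).trans ?_
    rw [hf, hg, smul_zero, smul_zero, add_zero]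

/-- The functional `z ↦ (1/2ħ)⟨z,v⟩_j`. -/
noncomputable def hermFunctional (hbar : ℝ) (Ω : V →ₗ[ℝ] V →ₗ[ℝ] ℝ)
    (hj : ∀ v w, Ω (Complex.I • v) (Complex.I • w) = Ω v w) (v : V) : V →ₗ[ℂ] ℂ where
  toFun z := (1 / (2 * (hbar : ℂ))) * ((Ω z (Complex.I • v) : ℂ) - Complex.I * (Ω z v : ℂ))
  map_add' x y := by
    simp only [map_add, LinearMap.add_apply, Complex.ofReal_add]
    ring
  map_smul' c z := by
    have hI : Ω (Complex.I • z) v = -Ω z (Complex.I • v) := by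
      rw [← hj z, smul_smul, Complex.I_mul_I, neg_one_smul, map_neg, neg_neg]
    have hc : c • z = c.re • z + c.im • (Complex.I • z) := by
      conv_lhs => rw [← Complex.re_add_im c]
      rw [add_smul, mul_smul, Complex.coe_smul, Complex.coe_smul]
    rw [hc]
    simp only [map_add, map_smul, LinearMap.add_apply, LinearMap.smul_apply, hj, hI, smul_eq_mul,
      RingHom.id_apply]
    conv_rhs => rw [← Complex.re_add_im c]
    push_cast
    linear_combination ((1 / (2 * (hbar : ℂ))) * c.im * (Ω z v : ℂ)) * Complex.I_sq

/-- Symplectic Clifford multiplication as an element of `End (Pol V)`. -/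
noncomputable def clEnd (hbar : ℝ) (Ω : V →ₗ[ℝ] V →ₗ[ℝ] ℝ)
    (hj : ∀ v w, Ω (Complex.I • v) (Complex.I • w) = Ω v w) (v : V) : Module.End ℂ (Pol V) :=
  LinearMap.mulLeft ℂ (⟨_, linearMap_mem_Pol (hermFunctional hbar Ω hj v)⟩ : Pol V)
    - (polDeriv v : Pol V →ₗ[ℂ] Pol V)

/-- The real-linear map underlying an additive map that commutes with real scalars in `ℂ`; the
real structure of the codomain is the restriction of its complex one. -/
noncomputable def realLinearMap {E : Type*} [Ring E] [Algebra ℂ E] (F : V → E)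
    (hadd : ∀ v w, F (v + w) = F v + F w)
    (hsmul : ∀ (c : ℝ) v, F (c • v) = (c : ℂ) • F v) : V →ₗ[ℝ] E where
  toFun := F
  map_add' := hadd
  map_smul' := hsmul

/-- Symplectic Clifford multiplication as a real-linear map into `End (Pol V)`. -/
noncomputable def clPol (hbar : ℝ) (Ω : V →ₗ[ℝ] V →ₗ[ℝ] ℝ)
    (hj : ∀ v w, Ω (Complex.I • v) (Complex.I • w) = Ω v w) :=
  realLinearMap (E := Module.End ℂ (Pol V)) (clEnd hbar Ω hj)
    (fun v w => by
      refine LinearMap.ext fun f => Subtype.ext <| funext fun z => ?_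
      simp [clEnd, hermFunctional, polDeriv_add]
      ring)
    (fun c v => by
      refine LinearMap.ext fun f => Subtype.ext <| funext fun z => ?_
      have e : Complex.I • c • v = c • Complex.I • v := smul_comm _ _ _
      simp [clEnd, hermFunctional, polDeriv_smul, e]
      ring)

section CliffordMultiplication

variable {hbar : ℝ} {Ω : V →ₗ[ℝ] V →ₗ[ℝ] ℝ}
  {hj : ∀ v w, Ω (Complex.I • v) (Complex.I • w) = Ω v w}

theorem coe_clPol (v : V) (f : Pol V) :
    (clPol hbar Ω hj v f : V → ℂ) = clOp hbar Ω v f := rfl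

theorem clPol_commutator (hbar0 : hbar ≠ 0) (halt : ∀ v, Ω v v = 0) (v w : V) :
    clPol hbar Ω hj v * clPol hbar Ω hj w - clPol hbar Ω hj w * clPol hbar Ω hj v
      = (Complex.I / hbar * (Ω v w : ℂ)) • (1 : Module.End ℂ (Pol V)) := by
  have hc : (hbar : ℂ) ≠ 0 := by exact_mod_cast hbar0
  have hneg : ∀ p q, Ω p q = -Ω q p := fun p q => (LinearMap.IsAlt.neg halt q p).symm
  have hκ : hermFunctional hbar Ω hj w v - hermFunctional hbar Ω hj v w
      = -(Complex.I / hbar * (Ω v w : ℂ)) := by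
    have hsymm : Ω w (Complex.I • v) = Ω v (Complex.I • w) := by
      rw [← hj w, smul_smul, Complex.I_mul_I, neg_one_smul, map_neg, ← hneg]
    change (1 / (2 * (hbar : ℂ))) * ((Ω v (Complex.I • w) : ℂ) - Complex.I * (Ω v w : ℂ))
      - (1 / (2 * (hbar : ℂ))) * ((Ω w (Complex.I • v) : ℂ) - Complex.I * (Ω w v : ℂ)) = _
    rw [hsymm, hneg w v]
    push_cast
    field_simp
    ring
  refine LinearMap.ext fun f => ?_
  set a : V → Pol V := fun v => ⟨_, linearMap_mem_Pol (hermFunctional hbar Ω hj v)⟩ with ha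
  have hcl : ∀ v g, clPol hbar Ω hj v g = a v * g - polDeriv v g := fun _ _ => rfl
  have hD : ∀ v w, polDeriv v (a w) = algebraMap ℂ (Pol V) (hermFunctional hbar Ω hj w v) :=
    fun v w => polDeriv_linearMap v _
  have hκ' := congrArg (algebraMap ℂ (Pol V)) hκ
  rw [map_sub, map_neg] at hκ'
  simp only [LinearMap.sub_apply, Module.End.mul_apply, LinearMap.smul_apply, Module.End.one_apply,
    hcl, map_sub, Derivation.leibniz, smul_eq_mul, hD, polDeriv_comm w v]
  rw [Algebra.smul_def]
  linear_combination (-f) * hκ'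

end CliffordMultiplication

end Pol

/-- there is a unique linear map `ν : sp(V,Ω) → End(Pol(V,j))` with
`ν(v̲⊗w + w̲⊗v) = −(iħ/2)(cl(v)cl(w) + cl(w)cl(v))`; it is a Lie algebra
homomorphism and satisfies `[ν(A), cl(x)] = cl(Ax)`. -/
theorem stmt10 {V : Type*} [AddCommGroup V] [Module ℂ V] [FiniteDimensional ℂ V]
    (hbar : ℝ) (hpos : 0 < hbar)
    (Ω : V →ₗ[ℝ] V →ₗ[ℝ] ℝ)
    (hΩalt : ∀ v, Ω v v = 0)
    (hΩnondeg : ∀ v, (∀ w, Ω v w = 0) → v = 0)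
    (hjsymp : ∀ v w, Ω (Complex.I • v) (Complex.I • w) = Ω v w)
    (hjpos : ∀ v, v ≠ 0 → 0 < Ω v (Complex.I • v)) :
    ∃ ν : Module.End ℝ V → (V → ℂ) → (V → ℂ),
      -- ν(A) is an endomorphism of Pol(V,j)
      (∀ A, IsSp Ω A → ∀ f ∈ Pol V, ν A f ∈ Pol V)
      -- ν is linear in A
      ∧ (∀ A B, IsSp Ω A → IsSp Ω B → ∀ f ∈ Pol V, ν (A + B) f = ν A f + ν B f)
      ∧ (∀ (c : ℝ) A, IsSp Ω A → ∀ f ∈ Pol V, ν (c • A) f = c • ν A f)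
      -- value on the generators v̲⊗w + w̲⊗v of sp(V,Ω)
      ∧ (∀ v w : V, ∀ f ∈ Pol V,
          ν (sOp Ω v w + sOp Ω w v) f
            = (-(Complex.I * (hbar : ℂ)) / 2)
                • (clOp hbar Ω v (clOp hbar Ω w f) + clOp hbar Ω w (clOp hbar Ω v f)))
      -- ν is a homomorphism of Lie algebras
      ∧ (∀ A B, IsSp Ω A → IsSp Ω B → ∀ f ∈ Pol V,
          ν (A * B - B * A) f = ν A (ν B f) - ν B (ν A f))
      -- [ν(A), cl(x)] = cl(Ax)
      ∧ (∀ A, IsSp Ω A → ∀ x : V, ∀ f ∈ Pol V,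
          ν A (clOp hbar Ω x f) - clOp hbar Ω x (ν A f) = clOp hbar Ω (A x) f)
      -- uniqueness
      ∧ (∀ ν' : Module.End ℝ V → (V → ℂ) → (V → ℂ),
          ((∀ A, IsSp Ω A → ∀ f ∈ Pol V, ν' A f ∈ Pol V)
            ∧ (∀ A B, IsSp Ω A → IsSp Ω B → ∀ f ∈ Pol V, ν' (A + B) f = ν' A f + ν' B f)
            ∧ (∀ (c : ℝ) A, IsSp Ω A → ∀ f ∈ Pol V, ν' (c • A) f = c • ν' A f)
            ∧ (∀ v w : V, ∀ f ∈ Pol V,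
                ν' (sOp Ω v w + sOp Ω w v) f
                  = (-(Complex.I * (hbar : ℂ)) / 2)
                      • (clOp hbar Ω v (clOp hbar Ω w f)
                          + clOp hbar Ω w (clOp hbar Ω v f)))) →
          ∀ A, IsSp Ω A → ∀ f ∈ Pol V, ν' A f = ν A f) := by
  classical
  have h0 : hbar ≠ 0 := hpos.ne'
  let b := Module.finBasis ℝ V
  obtain ⟨u, hu⟩ := exists_symplecticDual hΩnondeg b
  let cl := clPol hbar Ω hjsymp
  have hcl := clPol_commutator (hj := hjsymp) h0 hΩalt
  let N := metaplectic (E := Module.End ℂ (Pol V)) hbar b u cl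
  let ν : Module.End ℝ V → (V → ℂ) → (V → ℂ) :=
    fun A f => if hf : f ∈ Pol V then (N A ⟨f, hf⟩ : V → ℂ) else 0
  have hν : ∀ A (f : Pol V), ν A f = N A f := fun A f => dif_pos f.2
  have hgen : ∀ v w : V, ∀ f ∈ Pol V, ν (sOp Ω v w + sOp Ω w v) f
      = (-(Complex.I * (hbar : ℂ)) / 2)
        • (clOp hbar Ω v (clOp hbar Ω w f) + clOp hbar Ω w (clOp hbar Ω v f)) := by
    intro v w f hf
    lift f to Pol V using hf
    rw [hν]
    simp only [N, metaplectic_sOp_add hΩnondeg hu]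
    rfl
  refine ⟨ν, ?_, ?_, ?_, hgen, ?_, ?_, ?_⟩
  · intro A _ f hf
    lift f to Pol V using hf
    rw [hν]
    exact (N A f).2
  · intro A B _ _ f hf
    lift f to Pol V using hf
    simp only [hν, N, metaplectic_add]
    rfl
  · intro c A _ f hf
    lift f to Pol V using hf
    simp only [hν, N, metaplectic_smul]
    rfl
  · intro A B hA _ f hf
    lift f to Pol V using hf
    simp only [hν, N, metaplectic_lie h0 hΩalt hΩnondeg hu hcl hA, cl]
    rfl
  · intro A hA x f hf
    lift f to Pol V using hf
    have h := metaplectic_commutator h0 hΩalt hΩnondeg hu hcl hA x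
    simp only [hν, ← coe_clPol (hj := hjsymp), N, cl, ← h]
    rfl
  · rintro ν' ⟨-, hadd, hsmul, hgen'⟩ A hA f hf
    lift f to Pol V using hf
    have hsp := isSp_sOp_add (Ω := Ω) hΩalt
    have hsum : ∀ s : Finset (Fin (Module.finrank ℝ V)),
        IsSp Ω (∑ i ∈ s, (1 / 2 : ℝ) • (sOp Ω (u i) (A (b i)) + sOp Ω (A (b i)) (u i)))
        ∧ ν' (∑ i ∈ s, (1 / 2 : ℝ) • (sOp Ω (u i) (A (b i)) + sOp Ω (A (b i)) (u i))) f
          = ν (∑ i ∈ s, (1 / 2 : ℝ) • (sOp Ω (u i) (A (b i)) + sOp Ω (A (b i)) (u i))) f := by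
      intro s
      induction s using Finset.induction_on with
      | empty =>
        have hz : IsSp Ω 0 := fun x y => by simp
        have h1 := hsmul 0 0 hz f f.2
        rw [zero_smul, zero_smul] at h1
        refine ⟨by simpa using hz, ?_⟩
        rw [Finset.sum_empty, h1, hν]
        simp [N, metaplectic]
      | insert i s hi ih =>
        rw [Finset.sum_insert hi]
        set g := sOp Ω (u i) (A (b i)) + sOp Ω (A (b i)) (u i) with hg
        have hgsp : IsSp Ω g := hsp _ _
        have hg2 : IsSp Ω ((1 / 2 : ℝ) • g) := fun x y => by
          have := hgsp x y
          simp only [LinearMap.smul_apply, map_smul, smul_eq_mul]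
          rw [← mul_add, this, mul_zero]
        refine ⟨fun x y => ?_, ?_⟩
        · have h1 := hg2 x y
          have h2 := ih.1 x y
          simp only [LinearMap.add_apply, map_add] at h1 h2 ⊢
          linarith
        · rw [hadd _ _ hg2 ih.1 f f.2, hsmul _ _ hgsp f f.2, ih.2, hgen' _ _ f f.2,
            ← hgen _ _ f f.2, ← hg]
          simp only [hν, N, metaplectic_add, metaplectic_smul]
          rfl
    rw [eq_half_sum_sOp hΩalt hΩnondeg hu hA]
    exact (hsum _).2
end
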